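/- arXiv:2205.04171 — 4 statements merged into one kernel-verified Lean document; each statement's English description precedes it below -/
import Mathlib

section
/- Let (A, *, ∘) be a left skew brace. Then the assignment a ↦ λ_a is a group homomorphism from (A, ∘) to the automorphism group of (A, *); explicitly: λ_1 is the identity map of A, λ_{a ∘ b} = λ_a ∘ λ_b for all a, b ∈ A, and each λ_a is a bijection of A whose inverse is λ_{a^{-∘}}, with each λ_a a group endomorphism of (A, *). -/
/-- A digroup: a set with two group structures sharing the same identity element.
`mul`/`inv` is the `*` structure, `cmul`/`cinv` is the `∘` structure. -/
structure DiGroup (A : Type*) where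
  mul : A → A → A
  one : A
  inv : A → A
  mul_assoc : ∀ a b c, mul (mul a b) c = mul a (mul b c)
  one_mul : ∀ a, mul one a = a
  mul_one : ∀ a, mul a one = a
  inv_mul : ∀ a, mul (inv a) a = one
  mul_inv : ∀ a, mul a (inv a) = one
  cmul : A → A → A
  cinv : A → A
  cmul_assoc : ∀ a b c, cmul (cmul a b) c = cmul a (cmul b c)
  one_cmul : ∀ a, cmul one a = a
  cmul_one : ∀ a, cmul a one = a
  cinv_cmul : ∀ a, cmul (cinv a) a = one
  cmul_cinv : ∀ a, cmul a (cinv a) = one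

/-- A left skew brace: a digroup satisfying `a ∘ (b * c) = (a ∘ b) * a⁻¹ * (a ∘ c)`. -/
structure SkewBrace (A : Type*) extends DiGroup A where
  brace : ∀ a b c, cmul a (mul b c) = mul (mul (cmul a b) (inv a)) (cmul a c)

/-- The map `λ_a(u) = a⁻* * (a ∘ u)`. -/
def lam {A : Type*} (D : DiGroup A) (a u : A) : A := D.mul (D.inv a) (D.cmul a u)

/-- `a ↦ λ_a` is a group homomorphism `(A,∘) → Aut(A,*)`. -/
theorem lam_hom_to_aut {A : Type*} (S : SkewBrace A) :
    (∀ u, lam S.toDiGroup S.one u = u) ∧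
    (∀ a b u, lam S.toDiGroup (S.cmul a b) u = lam S.toDiGroup a (lam S.toDiGroup b u)) ∧
    (∀ a, Function.Bijective (lam S.toDiGroup a)) ∧
    (∀ a u, lam S.toDiGroup (S.cinv a) (lam S.toDiGroup a u) = u ∧
            lam S.toDiGroup a (lam S.toDiGroup (S.cinv a) u) = u) ∧
    (∀ a b c, lam S.toDiGroup a (S.mul b c) =
      S.mul (lam S.toDiGroup a b) (lam S.toDiGroup a c)) := by
  have key : ∀ a u, S.mul a (lam S.toDiGroup a u) = S.cmul a u := by
    intro a u
    rw [lam, ← S.mul_assoc, S.mul_inv, S.one_mul]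
  have canc : ∀ a b c, S.mul a b = S.mul a c → b = c := by
    intro a b c h
    rw [← S.one_mul b, ← S.inv_mul a, S.mul_assoc, h, ← S.mul_assoc, S.inv_mul, S.one_mul]
  have hend : ∀ a b c, lam S.toDiGroup a (S.mul b c) =
      S.mul (lam S.toDiGroup a b) (lam S.toDiGroup a c) := by
    intro a b c
    simp only [lam, S.brace, S.mul_assoc]
  have hone : ∀ u, lam S.toDiGroup S.one u = u := by
    intro u
    apply canc S.one
    rw [key, S.one_cmul, S.one_mul]
  have hmul : ∀ a b u, lam S.toDiGroup (S.cmul a b) u =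
      lam S.toDiGroup a (lam S.toDiGroup b u) := by
    intro a b u
    apply canc (S.cmul a b)
    rw [key, ← key a b, S.mul_assoc, ← hend, key b u, key, key, S.cmul_assoc]
  have hinv : ∀ a u, lam S.toDiGroup (S.cinv a) (lam S.toDiGroup a u) = u ∧
      lam S.toDiGroup a (lam S.toDiGroup (S.cinv a) u) = u := by
    intro a u
    rw [← hmul, ← hmul, S.cinv_cmul, S.cmul_cinv]
    exact ⟨hone u, hone u⟩
  exact ⟨hone, hmul, fun a => Function.bijective_iff_has_inverse.mpr
    ⟨lam S.toDiGroup (S.cinv a), fun u => (hinv a u).1, fun u => (hinv a u).2⟩, hinv, hend⟩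
end

section
/- Let (A, *, ∘) be a left skew brace and let I, J, K be ideals of A. Suppose that for all i, i' ∈ I and j, j' ∈ J one has ((i ∘ i') * (j ∘ j'))^{-∘} ∘ ((i * j) ∘ (i' * j')) ∈ K and ((i * i') * (j * j'))^{-*} * ((i * j) * (i' * j')) ∈ K (i.e., the map (i, j) ↦ (i * j) * K defines a skew brace morphism I × J → A/K). Then for all i ∈ I and j ∈ J: i ∘ j ∘ (j ∘ i)^{-∘} ∈ K, i * j * (j * i)^{-*} ∈ K, and (i ∘ j) * (i * j)^{-*} ∈ K. -/
/-- An ideal of a left skew brace: a normal subgroup for `*`, a normal subgroup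
for `∘`, invariant under every `λ_a`. -/
def IsIdeal {A : Type*} (S : SkewBrace A) (I : Set A) : Prop :=
  S.one ∈ I ∧
  (∀ x ∈ I, ∀ y ∈ I, S.mul x y ∈ I) ∧ (∀ x ∈ I, S.inv x ∈ I) ∧
  (∀ g ∈ I, ∀ k, S.mul (S.mul k g) (S.inv k) ∈ I) ∧
  (∀ x ∈ I, ∀ y ∈ I, S.cmul x y ∈ I) ∧ (∀ x ∈ I, S.cinv x ∈ I) ∧
  (∀ g ∈ I, ∀ k, S.cmul (S.cmul k g) (S.cinv k) ∈ I) ∧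
  (∀ a, ∀ x ∈ I, lam S.toDiGroup a x ∈ I)

@[reducible] def DiGroup.grpM {A : Type*} (S : DiGroup A) : Group A :=
  { mul := S.mul, one := S.one, inv := S.inv, mul_assoc := S.mul_assoc, one_mul := S.one_mul,
    mul_one := S.mul_one, inv_mul_cancel := S.inv_mul }

@[reducible] def DiGroup.grpC {A : Type*} (S : DiGroup A) : Group A :=
  { mul := S.cmul, one := S.one, inv := S.cinv, mul_assoc := S.cmul_assoc, one_mul := S.one_cmul,
    mul_one := S.cmul_one, inv_mul_cancel := S.cinv_cmul }

theorem aux_grp1 {G : Type*} [Group G] (x y : G) : y * (x⁻¹ * y)⁻¹ * y⁻¹ = x * y⁻¹ := by group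

theorem aux_grp2 {G : Type*} [Group G] (u x y : G) :
    u * ((u⁻¹ * x) * (u⁻¹ * y)⁻¹) * u⁻¹ = x * y⁻¹ := by group

theorem aux_grp3 {G : Type*} [Group G] (u x : G) : u * (u⁻¹ * x) = x := by group

/-- if `(i,j) ↦ i * j * K` is a skew brace morphism `I × J → A/K`,
then `K` contains the three kinds of commutator generators. -/
theorem generators_mem_of_morphism {A : Type*} (S : SkewBrace A) (I J K : Set A)
    (hI : IsIdeal S I) (hJ : IsIdeal S J) (hK : IsIdeal S K)
    (hmor : ∀ i ∈ I, ∀ i' ∈ I, ∀ j ∈ J, ∀ j' ∈ J,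
      S.cmul (S.cinv (S.mul (S.cmul i i') (S.cmul j j'))) (S.cmul (S.mul i j) (S.mul i' j')) ∈ K ∧
      S.mul (S.inv (S.mul (S.mul i i') (S.mul j j'))) (S.mul (S.mul i j) (S.mul i' j')) ∈ K) :
    ∀ i ∈ I, ∀ j ∈ J,
      S.cmul (S.cmul i j) (S.cinv (S.cmul j i)) ∈ K ∧
      S.mul (S.mul i j) (S.inv (S.mul j i)) ∈ K ∧
      S.mul (S.cmul i j) (S.inv (S.mul i j)) ∈ K := by
  intro i hi j hj
  obtain ⟨-, kmul, kinv, kconj, kcmul, kcinv, kcconj, klam⟩ := hK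
  obtain ⟨h1, h2⟩ := hmor S.one hI.1 i hi j hj S.one hJ.1
  obtain ⟨h3, -⟩ := hmor i hi S.one hI.1 S.one hJ.1 j hj
  simp only [S.one_mul, S.mul_one, S.one_cmul, S.cmul_one] at h1 h2 h3
  refine ⟨?_, ?_, ?_⟩
  · have h := kcconj _ (kcmul _ h3 _ (kcinv _ h1)) (S.mul i j)
    have e := @aux_grp2 A S.grpC (S.mul i j) (S.cmul i j) (S.cmul j i)
    exact (congrArg (fun z => z ∈ K) e).mp h
  · have h := kconj _ (kinv _ h2) (S.mul j i)
    have e := @aux_grp1 A S.grpM (S.mul i j) (S.mul j i)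
    exact (congrArg (fun z => z ∈ K) e).mp h
  · have h := kconj _ (klam (S.mul i j) _ h3) (S.mul i j)
    have e : S.cmul (S.mul i j) (S.cmul (S.cinv (S.mul i j)) (S.cmul i j)) = S.cmul i j :=
      @aux_grp3 A S.grpC (S.mul i j) (S.cmul i j)
    have e2 : S.mul (S.mul i j) (S.mul (S.inv (S.mul i j)) (S.cmul i j)) = S.cmul i j :=
      @aux_grp3 A S.grpM (S.mul i j) (S.cmul i j)
    unfold lam at h
    rw [e, e2] at h
    exact h
end

section
/- Let (A, *, ∘) be a left skew brace and let I, J, K be ideals of A. Suppose K contains the three sets {i ∘ j ∘ (j ∘ i)^{-∘} : i ∈ I, j ∈ J}, {i * j * (j * i)^{-*} : i ∈ I, j ∈ J}, and {(i ∘ j) * (i * j)^{-*} : i ∈ I, j ∈ J}. Then for all i, i' ∈ I and j, j' ∈ J one has ((i ∘ i') * (j ∘ j'))^{-∘} ∘ ((i * j) ∘ (i' * j')) ∈ K and ((i * i') * (j * j'))^{-*} * ((i * j) * (i' * j')) ∈ K; that is, the map (i, j) ↦ (i * j) * K defines a skew brace morphism I × J → A/K. -/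
theorem grp_aux {G : Type*} [Group G] (K : Set G) (h1 : (1 : G) ∈ K)
    (hm : ∀ x ∈ K, ∀ y ∈ K, x * y ∈ K) (hi : ∀ x ∈ K, x⁻¹ ∈ K)
    (hc : ∀ g ∈ K, ∀ k, k * g * k⁻¹ ∈ K) :
    (∀ a : G, a⁻¹ * a ∈ K) ∧ (∀ a b : G, a⁻¹ * b ∈ K → b⁻¹ * a ∈ K) ∧
    (∀ a b c : G, a⁻¹ * b ∈ K → b⁻¹ * c ∈ K → a⁻¹ * c ∈ K) ∧
    (∀ a b c d : G, a⁻¹ * b ∈ K → c⁻¹ * d ∈ K → (a * c)⁻¹ * (b * d) ∈ K) ∧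
    (∀ a b : G, a * b⁻¹ ∈ K → a⁻¹ * b ∈ K) := by
  refine ⟨fun a => by simpa using h1, fun a b h => by simpa using hi _ h,
    fun a b c h h' => by simpa [mul_assoc] using hm _ h _ h',
    fun a b c d h h' => by
      simpa [mul_assoc] using hm _ (hc _ h c⁻¹) _ h', fun a b h => ?_⟩
  simpa [mul_assoc] using hc _ (hi _ h) a⁻¹ |> fun h => by
    simpa [mul_assoc] using h

@[reducible]
def DiGroup.grp {A : Type*} (D : DiGroup A) : Group A where
  mul := D.mul
  one := D.one
  inv := D.inv
  mul_assoc := D.mul_assoc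
  one_mul := D.one_mul
  mul_one := D.mul_one
  inv_mul_cancel := D.inv_mul

def DiGroup.swap {A : Type*} (D : DiGroup A) : DiGroup A :=
  ⟨D.cmul, D.one, D.cinv, D.cmul_assoc, D.one_cmul, D.cmul_one, D.cinv_cmul, D.cmul_cinv,
   D.mul, D.inv, D.mul_assoc, D.one_mul, D.mul_one, D.inv_mul, D.mul_inv⟩

theorem digrp_aux {A : Type*} (D : DiGroup A) (K : Set A) (h1 : D.one ∈ K)
    (hm : ∀ x ∈ K, ∀ y ∈ K, D.mul x y ∈ K) (hi : ∀ x ∈ K, D.inv x ∈ K)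
    (hc : ∀ g ∈ K, ∀ k, D.mul (D.mul k g) (D.inv k) ∈ K) :
    (∀ a, D.mul (D.inv a) a ∈ K) ∧
    (∀ a b, D.mul (D.inv a) b ∈ K → D.mul (D.inv b) a ∈ K) ∧
    (∀ a b c, D.mul (D.inv a) b ∈ K → D.mul (D.inv b) c ∈ K → D.mul (D.inv a) c ∈ K) ∧
    (∀ a b c d, D.mul (D.inv a) b ∈ K → D.mul (D.inv c) d ∈ K →
      D.mul (D.inv (D.mul a c)) (D.mul b d) ∈ K) ∧
    (∀ a b, D.mul a (D.inv b) ∈ K → D.mul (D.inv a) b ∈ K) :=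
  @grp_aux A D.grp K h1 hm hi hc

/-- if `K` contains the three sets of generators, then
`(i,j) ↦ i * j * K` is a skew brace morphism `I × J → A/K`. -/
theorem morphism_of_generators_mem {A : Type*} (S : SkewBrace A) (I J K : Set A)
    (hI : IsIdeal S I) (hJ : IsIdeal S J) (hK : IsIdeal S K)
    (hgen1 : ∀ i ∈ I, ∀ j ∈ J, S.cmul (S.cmul i j) (S.cinv (S.cmul j i)) ∈ K)
    (hgen2 : ∀ i ∈ I, ∀ j ∈ J, S.mul (S.mul i j) (S.inv (S.mul j i)) ∈ K)
    (hgen3 : ∀ i ∈ I, ∀ j ∈ J, S.mul (S.cmul i j) (S.inv (S.mul i j)) ∈ K) :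
    ∀ i ∈ I, ∀ i' ∈ I, ∀ j ∈ J, ∀ j' ∈ J,
      S.cmul (S.cinv (S.mul (S.cmul i i') (S.cmul j j'))) (S.cmul (S.mul i j) (S.mul i' j')) ∈ K ∧
      S.mul (S.inv (S.mul (S.mul i i') (S.mul j j'))) (S.mul (S.mul i j) (S.mul i' j')) ∈ K := by
  obtain ⟨k1, km, ki, kc, km', ki', kc', kl⟩ := hK
  obtain ⟨r, s, t, m, g⟩ := digrp_aux S.toDiGroup K k1 km ki kc
  obtain ⟨r', s', t', m', g'⟩ := digrp_aux S.toDiGroup.swap K k1 km' ki' kc'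
  simp only [DiGroup.swap] at r' s' t' m' g'
  have cm : ∀ a b, S.mul (S.inv a) b ∈ K → S.cmul (S.cinv a) b ∈ K := by
    intro a b h
    have h2 := kl (S.cinv a) _ h
    -- lam_{a'}(a⁻¹ b) = a'⁻¹ * (a' ∘ (a⁻¹ * b)) = a' ∘ b
    have e1 := S.brace (S.cinv a) a (S.mul (S.inv a) b)
    rw [← S.mul_assoc, S.mul_inv, S.one_mul, S.cinv_cmul, S.one_mul] at e1
    rw [e1]; exact h2
  have mc : ∀ a b, S.cmul (S.cinv a) b ∈ K → S.mul (S.inv a) b ∈ K := by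
    intro a b h
    have h2 := kl a _ h
    unfold lam at h2
    rwa [← S.cmul_assoc, S.cmul_cinv, S.one_cmul] at h2
  intro i hi i' hi' j hj j' hj'
  have hii := hI.2.2.2.2.1 i hi i' hi'
  have hjj := hJ.2.2.2.2.1 j hj j' hj'
  constructor
  · have a1 := m' _ _ _ _ (s' _ _ (cm _ _ (g _ _ (hgen3 i hi j hj))))
      (s' _ _ (cm _ _ (g _ _ (hgen3 i' hi' j' hj'))))
    have a2 := m' _ _ _ _ (r' i) (m' _ _ _ _ (g' _ _ (hgen1 i' hi' j hj)) (r' j'))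
    have a3 := s' _ _ (cm _ _ (g _ _ (hgen3 _ hii _ hjj)))
    simp only [S.cmul_assoc] at a1 a2 a3 ⊢
    exact t' _ _ _ a3 (t' _ _ _ a2 (s' _ _ a1))
  · have a2 := m _ _ _ _ (r i) (m _ _ _ _ (g _ _ (hgen2 i' hi' j hj)) (r j'))
    simp only [S.mul_assoc] at a2 ⊢
    exact a2
end

section
/- Let (A, *, ∘) be a left skew brace and let J₁, J₂ be ideals of A. Then the product sets with respect to the two operations coincide: {j₁ * j₂ : j₁ ∈ J₁, j₂ ∈ J₂} = {j₁ ∘ j₂ : j₁ ∈ J₁, j₂ ∈ J₂}, and this set is the join of J₁ and J₂ in the lattice of ideals of A (in particular, it is itself an ideal of A). -/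
theorem aux_prod {A : Type*} [Group A] (J K : Set A)
    (j0 : (1:A) ∈ J) (j1 : ∀ x ∈ J, ∀ y ∈ J, x * y ∈ J) (j2 : ∀ x ∈ J, x⁻¹ ∈ J)
    (j3 : ∀ g ∈ J, ∀ k, k * g * k⁻¹ ∈ J)
    (k0 : (1:A) ∈ K) (k1 : ∀ x ∈ K, ∀ y ∈ K, x * y ∈ K) (k2 : ∀ x ∈ K, x⁻¹ ∈ K)
    (k3 : ∀ g ∈ K, ∀ k, k * g * k⁻¹ ∈ K) (P : Set A)
    (hP : P = {x | ∃ a ∈ J, ∃ b ∈ K, x = a * b}) :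
    (1:A) ∈ P ∧ (∀ x ∈ P, ∀ y ∈ P, x * y ∈ P) ∧ (∀ x ∈ P, x⁻¹ ∈ P) ∧
    (∀ g ∈ P, ∀ k, k * g * k⁻¹ ∈ P) := by
  subst hP
  refine ⟨⟨1, j0, 1, k0, by simp⟩, ?_, ?_, ?_⟩
  · rintro _ ⟨a, ha, b, hb, rfl⟩ _ ⟨c, hc, d, hd, rfl⟩
    exact ⟨a * (b * c * b⁻¹), j1 _ ha _ (j3 _ hc _), b * d, k1 _ hb _ hd, by group⟩
  · rintro _ ⟨a, ha, b, hb, rfl⟩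
    exact ⟨b⁻¹ * a⁻¹ * b⁻¹⁻¹, j3 _ (j2 _ ha) _, b⁻¹, k2 _ hb, by group⟩
  · rintro _ ⟨a, ha, b, hb, rfl⟩ k
    exact ⟨k * a * k⁻¹, j3 _ ha _, k * b * k⁻¹, k3 _ hb _, by group⟩

/-- The star group. -/
@[reducible] def grpStar {A : Type*} (D : DiGroup A) : Group A where
  mul := D.mul
  one := D.one
  inv := D.inv
  mul_assoc := D.mul_assoc
  one_mul := D.one_mul
  mul_one := D.mul_one
  inv_mul_cancel := D.inv_mul

/-- The circle group. -/
@[reducible] def grpCirc {A : Type*} (D : DiGroup A) : Group A where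
  mul := D.cmul
  one := D.one
  inv := D.cinv
  mul_assoc := D.cmul_assoc
  one_mul := D.one_cmul
  mul_one := D.cmul_one
  inv_mul_cancel := D.cinv_cmul

theorem cmul_eq_lam {A : Type*} (D : DiGroup A) (a b : A) :
    D.cmul a b = D.mul a (lam D a b) := by
  rw [lam, ← D.mul_assoc, D.mul_inv, D.one_mul]

theorem lam_mul {A : Type*} (S : SkewBrace A) (a b c : A) :
    lam S.toDiGroup a (S.mul b c) = S.mul (lam S.toDiGroup a b) (lam S.toDiGroup a c) := by
  simp only [lam, S.brace, S.mul_assoc]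

theorem lam_cinv {A : Type*} (S : SkewBrace A) (a b : A) :
    lam S.toDiGroup a (lam S.toDiGroup (S.cinv a) b) = b := by
  have e : S.cmul a (S.mul (S.cinv a) (lam S.toDiGroup (S.cinv a) b)) = b := by
    rw [← cmul_eq_lam, ← S.cmul_assoc, S.cmul_cinv, S.one_cmul]
  rw [S.brace, S.cmul_cinv, S.one_mul] at e
  exact e

theorem mul_eq_lam {A : Type*} (S : SkewBrace A) (a b : A) :
    S.mul a b = S.cmul a (lam S.toDiGroup (S.cinv a) b) := by
  rw [cmul_eq_lam, lam_cinv]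

/-- for ideals `J₁, J₂`, the product sets `J₁ * J₂` and `J₁ ∘ J₂`
coincide and give the join of `J₁` and `J₂` in the lattice of ideals. -/
theorem ideal_join {A : Type*} (S : SkewBrace A) (J1 J2 : Set A)
    (h1 : IsIdeal S J1) (h2 : IsIdeal S J2) :
    {x | ∃ a ∈ J1, ∃ b ∈ J2, x = S.mul a b} = {x | ∃ a ∈ J1, ∃ b ∈ J2, x = S.cmul a b} ∧
    IsIdeal S {x | ∃ a ∈ J1, ∃ b ∈ J2, x = S.mul a b} ∧
    J1 ⊆ {x | ∃ a ∈ J1, ∃ b ∈ J2, x = S.mul a b} ∧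
    J2 ⊆ {x | ∃ a ∈ J1, ∃ b ∈ J2, x = S.mul a b} ∧
    (∀ L, IsIdeal S L → J1 ⊆ L → J2 ⊆ L →
      {x | ∃ a ∈ J1, ∃ b ∈ J2, x = S.mul a b} ⊆ L) := by
  have heq : {x | ∃ a ∈ J1, ∃ b ∈ J2, x = S.mul a b} =
      {x | ∃ a ∈ J1, ∃ b ∈ J2, x = S.cmul a b} := by
    ext x
    constructor
    · rintro ⟨a, ha, b, hb, rfl⟩
      exact ⟨a, ha, _, h2.2.2.2.2.2.2.2 _ _ hb, mul_eq_lam S a b⟩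
    · rintro ⟨a, ha, b, hb, rfl⟩
      exact ⟨a, ha, _, h2.2.2.2.2.2.2.2 _ _ hb, cmul_eq_lam _ a b⟩
  obtain ⟨a0, a1, a2, a3, a4, a5, a6, a7⟩ := h1
  obtain ⟨b0, b1, b2, b3, b4, b5, b6, b7⟩ := h2
  obtain ⟨p0, p1, p2, p3⟩ := @aux_prod A (grpStar S.toDiGroup) J1 J2 a0 a1 a2 a3 b0 b1 b2 b3 _ rfl
  obtain ⟨-, q1, q2, q3⟩ := @aux_prod A (grpCirc S.toDiGroup) J1 J2 a0 a4 a5 a6 b0 b4 b5 b6 _ heq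
  refine ⟨heq, ⟨p0, p1, p2, p3, q1, q2, q3, ?_⟩, ?_, ?_, ?_⟩
  · rintro k _ ⟨a, ha, b, hb, rfl⟩
    exact ⟨_, a7 k _ ha, _, b7 k _ hb, lam_mul S k a b⟩
  · intro x hx
    exact ⟨x, hx, S.one, b0, (S.mul_one x).symm⟩
  · intro x hx
    exact ⟨S.one, a0, x, hx, (S.one_mul x).symm⟩
  · rintro L hL hJ hK _ ⟨a, ha, b, hb, rfl⟩
    exact hL.2.1 _ (hJ ha) _ (hK hb)
end
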